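/- For the entanglement witness W[1,1,1,0] on ℂ⁴ ⊗ ℂ⁴ (arising from the generalized Choi map Φ[1,1,1,0]), the complex linear span of the set of product vectors { ψ⊗φ : ψ, φ ∈ ℂ⁴, ⟨ψ⊗φ| W[1,1,1,0] |ψ⊗φ⟩ = 0 } has dimension 13; in particular this set does not span ℂ⁴ ⊗ ℂ⁴ (W[1,1,1,0] lacks the spanning property). The same holds for W[1,0,1,1]. -/

import Mathlib

open Complex Matrix ComplexOrder

/-- The entanglement witness `W[a,b,c,d]` on `ℂ⁴ ⊗ ℂ⁴`, identified with a
`16 × 16` complex matrix in the product basis `|i,j⟩`, indices mod 4. -/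
noncomputable def W4 (a b c d : ℝ) :
    Matrix (Fin 4 × Fin 4) (Fin 4 × Fin 4) ℂ := fun p q =>
  if p = q then
    (if p.2 = p.1 then (a : ℂ)
     else if p.2 = p.1 + 1 then (b : ℂ)
     else if p.2 = p.1 + 2 then (c : ℂ)
     else (d : ℂ))
  else if p.1 = p.2 ∧ q.1 = q.2 then -1 else 0

/-- The product vector `ψ ⊗ φ`. -/
def prodVec {α β : Type*} (ψ : α → ℂ) (φ : β → ℂ) : α × β → ℂ :=
  fun p => ψ p.1 * φ p.2

/-- The pairing `⟨v| X |v⟩`. -/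
noncomputable def pairing {n : Type*} [Fintype n] (X : Matrix n n ℂ) (v : n → ℂ) : ℂ :=
  star v ⬝ᵥ X.mulVec v

lemma pairing_W4_prodVec (a b c d : ℝ) (ψ φ : Fin 4 → ℂ) :
    pairing (W4 a b c d) (prodVec ψ φ) =
      ((∑ i, normSq (ψ i) * ((a + 1) * normSq (φ i) + b * normSq (φ (i + 1)) +
        c * normSq (φ (i + 2)) + d * normSq (φ (i + 3))) -
        normSq (∑ i, ψ i * φ i) : ℝ) : ℂ) := by
  have hW : ∀ p q : Fin 4 × Fin 4, W4 a b c d p q =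
      (if p = q then (if p.2 = p.1 then (a : ℂ) + 1
        else if p.2 = p.1 + 1 then (b : ℂ)
        else if p.2 = p.1 + 2 then (c : ℂ)
        else (d : ℂ)) else 0) -
      (if p.1 = p.2 then 1 else 0) * (if q.1 = q.2 then 1 else 0) := by
    rintro ⟨i, j⟩ ⟨k, l⟩
    unfold W4
    by_cases h : (i, j) = (k, l)
    · obtain ⟨rfl, rfl⟩ := Prod.mk.inj h
      by_cases hij : j = i
      · simp [hij]
      · simp [hij, Ne.symm hij]
    · rw [if_neg h, if_neg h]
      by_cases h1 : i = j <;> by_cases h2 : k = l <;> simp [h1, h2]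
  have hmul : ∀ p : Fin 4 × Fin 4, (W4 a b c d).mulVec (prodVec ψ φ) p =
      (if p.2 = p.1 then (a : ℂ) + 1
        else if p.2 = p.1 + 1 then (b : ℂ)
        else if p.2 = p.1 + 2 then (c : ℂ)
        else (d : ℂ)) * prodVec ψ φ p -
      (if p.1 = p.2 then 1 else 0) * ∑ i, ψ i * φ i := by
    intro p
    simp only [Matrix.mulVec, dotProduct, hW, sub_mul, Finset.sum_sub_distrib, ite_mul, zero_mul,
      Finset.sum_ite_eq, Finset.mem_univ, if_true, mul_assoc]
    congr 2
    simp [Fintype.sum_prod_type, prodVec]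
  simp only [pairing, dotProduct, hmul, Fintype.sum_prod_type, Pi.star_apply, prodVec]
  push_cast
  simp only [normSq_eq_conj_mul_self, Fin.sum_univ_four, star_def, map_mul, map_add]
  simp [Fin.ext_iff]
  ring

set_option maxHeartbeats 400000 in
lemma sum_div_lt_one_or_eq {a b c d : ℝ} (ha : 0 ≤ a) (hb : 0 ≤ b) (hc : 0 ≤ c) (hd : 0 ≤ d) :
    a / (2 * a + b + c) + b / (2 * b + c + d) + c / (2 * c + d + a) + d / (2 * d + a + b) < 1 ∨
      a = b ∧ b = c ∧ c = d := by
  have half_lt : ∀ t : ℝ, t / (2 * t) < 1 := fun t => by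
    rcases eq_or_ne t 0 with rfl | ht
    · simp
    · rw [div_mul_cancel_right₀ ht]; norm_num
  rcases (by positivity : 0 ≤ 2 * a + b + c).eq_or_lt with h | hA
  · obtain rfl : a = 0 := by linarith
    obtain rfl : b = 0 := by linarith
    obtain rfl : c = 0 := by linarith
    left; simpa using half_lt d
  rcases (by positivity : 0 ≤ 2 * b + c + d).eq_or_lt with h | hB
  · obtain rfl : b = 0 := by linarith
    obtain rfl : c = 0 := by linarith
    obtain rfl : d = 0 := by linarith
    left; simpa using half_lt a
  rcases (by positivity : 0 ≤ 2 * c + d + a).eq_or_lt with h | hC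
  · obtain rfl : c = 0 := by linarith
    obtain rfl : d = 0 := by linarith
    obtain rfl : a = 0 := by linarith
    left; simpa using half_lt b
  rcases (by positivity : 0 ≤ 2 * d + a + b).eq_or_lt with h | hD
  · obtain rfl : d = 0 := by linarith
    obtain rfl : a = 0 := by linarith
    obtain rfl : b = 0 := by linarith
    left; simpa using half_lt c
  have hcyc : 0 ≤ a * d * (a - b) ^ 2 + b * a * (b - c) ^ 2 + c * b * (c - d) ^ 2 +
      d * c * (d - a) ^ 2 := by positivity
  have hquad₁ : 0 ≤ (a - c) ^ 2 - (a - c) * (b - d) + 2 * (b - d) ^ 2 := by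
    nlinarith [sq_nonneg (a - c - (b - d)), sq_nonneg (a - c), sq_nonneg (b - d)]
  have hquad₂ : 0 ≤ (b - d) ^ 2 + (a - c) * (b - d) + 2 * (a - c) ^ 2 := by
    nlinarith [sq_nonneg (a - c + (b - d)), sq_nonneg (a - c), sq_nonneg (b - d)]
  have hac := mul_nonneg (mul_nonneg ha hc) hquad₁
  have hbd := mul_nonneg (mul_nonneg hb hd) hquad₂
  have hsum : a / (2 * a + b + c) + b / (2 * b + c + d) + c / (2 * c + d + a) +
      d / (2 * d + a + b) = 1 -
      (a * d * (a - b) ^ 2 + b * a * (b - c) ^ 2 + c * b * (c - d) ^ 2 + d * c * (d - a) ^ 2 +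
        3 * (a * c - b * d) ^ 2 + ((a - c) * (b - d)) ^ 2 +
        a * c * ((a - c) ^ 2 - (a - c) * (b - d) + 2 * (b - d) ^ 2) +
        b * d * ((b - d) ^ 2 + (a - c) * (b - d) + 2 * (a - c) ^ 2)) /
      ((2 * a + b + c) * (2 * b + c + d) * (2 * c + d + a) * (2 * d + a + b)) := by
    have hnum : (a * d * (a - b) ^ 2 + b * a * (b - c) ^ 2 + c * b * (c - d) ^ 2 + d * c * (d - a) ^ 2 +
        3 * (a * c - b * d) ^ 2 + ((a - c) * (b - d)) ^ 2 +
        a * c * ((a - c) ^ 2 - (a - c) * (b - d) + 2 * (b - d) ^ 2) +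
        b * d * ((b - d) ^ 2 + (a - c) * (b - d) + 2 * (a - c) ^ 2)) =
      (2 * a + b + c) * (2 * b + c + d) * (2 * c + d + a) * (2 * d + a + b) -
      (a * ((2 * b + c + d) * (2 * c + d + a) * (2 * d + a + b)) +
        b * ((2 * a + b + c) * (2 * c + d + a) * (2 * d + a + b)) +
        c * ((2 * a + b + c) * (2 * b + c + d) * (2 * d + a + b)) +
        d * ((2 * a + b + c) * (2 * b + c + d) * (2 * c + d + a))) := by ring
    rw [hnum]
    generalize 2 * a + b + c = A at *
    generalize 2 * b + c + d = B at *
    generalize 2 * c + d + a = C at *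
    generalize 2 * d + a + b = D at *
    field_simp
    ring
  refine or_iff_not_imp_left.2 fun hlt => ?_
  rw [hsum, sub_lt_self_iff, div_pos_iff_of_pos_right (by positivity), not_lt] at hlt
  have hsq₁ := sq_nonneg (a * c - b * d)
  have hsq₂ := sq_nonneg ((a - c) * (b - d))
  have hprod : a * c = b * d := sub_eq_zero.1 (pow_eq_zero_iff two_ne_zero |>.1 (by linarith))
  have hdiff : (a - c) * (b - d) = 0 := pow_eq_zero_iff two_ne_zero |>.1 (by linarith)
  have hac_zero : a * c * ((a - c) ^ 2 - (a - c) * (b - d) + 2 * (b - d) ^ 2) = 0 := by linarith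
  rw [hdiff] at hac_zero
  rcases (mul_nonneg ha hc).eq_or_lt with h0 | hpos
  · exfalso
    have h0' : b * d = 0 := by rw [← hprod, ← h0]
    rcases mul_eq_zero.1 hdiff with h | h
    · obtain rfl : a = c := by linarith
      obtain rfl : a = 0 := by simpa using h0.symm
      rcases mul_eq_zero.1 h0' with rfl | rfl <;> simp at hA hB hC hD
    · obtain rfl : b = d := by linarith
      obtain rfl : b = 0 := by simpa using h0'
      rcases mul_eq_zero.1 h0.symm with rfl | rfl <;> simp at hA hB hC hD
  · have hsq := (mul_eq_zero.1 hac_zero).resolve_left hpos.ne'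
    obtain rfl : a = c := by nlinarith [sq_nonneg (a - c), sq_nonneg (b - d)]
    obtain rfl : b = d := by nlinarith [sq_nonneg (b - d)]
    obtain rfl : a = b := by nlinarith
    simp

lemma eq_of_four_mul_sum_normSq {z : Fin 4 → ℂ}
    (h : 4 * ∑ i, normSq (z i) = normSq (∑ i, z i)) (i : Fin 4) : z i = z 0 := by
  have hid : normSq (z 1 - z 0) + normSq (z 2 - z 0) + normSq (z 3 - z 0) + normSq (z 2 - z 1) +
      normSq (z 3 - z 1) + normSq (z 3 - z 2) = 0 := by
    rw [← sub_eq_zero.2 h]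
    simp only [Fin.sum_univ_four, normSq_apply, sub_re, sub_im, add_re, add_im]
    ring
  have hn := fun w : ℂ => normSq_nonneg w
  rw [← sub_eq_zero, ← normSq_eq_zero]
  have := hn (z 1 - z 0); have := hn (z 2 - z 0); have := hn (z 3 - z 0)
  have := hn (z 2 - z 1); have := hn (z 3 - z 1); have := hn (z 3 - z 2)
  fin_cases i
  · simp
  all_goals dsimp; linarith

lemma mul_eq_of_choi_form_eq_zero {x y : Fin 4 → ℂ}
    (h : ∑ i, normSq (x i) * (2 * normSq (y i) + normSq (y (i + 1)) + normSq (y (i + 2))) =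
      normSq (∑ i, x i * y i)) (i : Fin 4) : x i * y i = x 0 * y 0 := by
  set L : Fin 4 → ℝ := fun i => 2 * normSq (y i) + normSq (y (i + 1)) + normSq (y (i + 2)) with hL
  have hn := fun w : ℂ => normSq_nonneg w
  have hL0 : ∀ i, 0 ≤ L i := fun i => by
    have := hn (y i); have := hn (y (i + 1)); have := hn (y (i + 2))
    simp only [hL]; positivity
  have hterm : ∀ i, 0 ≤ normSq (x i) * L i := fun i => mul_nonneg (hn _) (hL0 i)
  have hy_of_L : ∀ i, L i = 0 → normSq (y i) = 0 := fun i hi => by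
    have := hn (y i); have := hn (y (i + 1)); have := hn (y (i + 2))
    simp only [hL] at hi; linarith
  have hCS : normSq (∑ i, x i * y i) ≤
      (∑ i, normSq (x i) * L i) * ∑ i, normSq (y i) / L i := by
    calc normSq (∑ i, x i * y i) ≤ (∑ i, ‖x i * y i‖) ^ 2 := by
          rw [normSq_eq_norm_sq]; gcongr; exact norm_sum_le _ _
      _ ≤ _ := by
          refine Finset.sum_sq_le_sum_mul_sum_of_sq_le_mul _ (fun i _ => hterm i)
            (fun i _ => div_nonneg (hn _) (hL0 i)) fun i _ => ?_
          rw [norm_mul, mul_pow, ← normSq_eq_norm_sq, ← normSq_eq_norm_sq]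
          rcases eq_or_ne (L i) 0 with hi | hi
          · simp [hi, hy_of_L i hi]
          · exact le_of_eq (by field_simp)
  rw [← h] at hCS
  rcases sum_div_lt_one_or_eq (hn (y 0)) (hn (y 1)) (hn (y 2)) (hn (y 3)) with hlt | ⟨h1, h2, h3⟩
  · have hlt' : ∑ i, normSq (y i) / L i < 1 := by
      simpa [Fin.sum_univ_four, hL, Fin.reduceAdd] using hlt
    have hnonneg := Finset.sum_nonneg fun i (_ : i ∈ Finset.univ) => hterm i
    have hzero : ∑ i, normSq (x i) * L i = 0 := by nlinarith
    have hmul : ∀ i, x i * y i = 0 := fun i => by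
      rcases mul_eq_zero.1
        ((Finset.sum_eq_zero_iff_of_nonneg fun i _ => hterm i).1 hzero i (Finset.mem_univ i))
        with hx | hi
      · simp [normSq_eq_zero.1 hx]
      · simp [normSq_eq_zero.1 (hy_of_L i hi)]
    rw [hmul, hmul]
  · refine eq_of_four_mul_sum_normSq (z := fun i => x i * y i) ?_ i
    rw [← h]
    simp only [Fin.sum_univ_four, normSq_mul, Fin.reduceAdd, ← h3, ← h2, ← h1]
    ring

/-- The vectors of `ℂ⁴ ⊗ ℂ⁴` with constant diagonal. -/
def constDiag : Submodule ℂ (Fin 4 × Fin 4 → ℂ) :=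
  LinearMap.ker (LinearMap.pi fun k : Fin 3 =>
    LinearMap.proj (R := ℂ) (φ := fun _ : Fin 4 × Fin 4 => ℂ) (k.succ, k.succ) -
      LinearMap.proj (0, 0))

lemma mem_constDiag {v : Fin 4 × Fin 4 → ℂ} : v ∈ constDiag ↔ ∀ i, v (i, i) = v (0, 0) := by
  rw [Fin.forall_fin_succ]
  simp [constDiag, LinearMap.mem_ker, funext_iff, sub_eq_zero]

lemma finrank_constDiag : Module.finrank ℂ constDiag = 13 := by
  have hrn := LinearMap.finrank_range_add_finrank_ker (LinearMap.pi fun k : Fin 3 =>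
    LinearMap.proj (R := ℂ) (φ := fun _ : Fin 4 × Fin 4 => ℂ) (k.succ, k.succ) -
      LinearMap.proj (0, 0))
  rw [LinearMap.range_eq_top.2, finrank_top] at hrn
  · simp only [Module.finrank_fintype_fun_eq_card, Fintype.card_prod, Fintype.card_fin] at hrn
    unfold constDiag
    omega
  · intro w
    refine ⟨fun p => (Fin.cons 0 w : Fin 4 → ℂ) p.1, ?_⟩
    ext k
    simp

lemma single_mem_of_phases {S : Submodule ℂ (Fin 4 × Fin 4 → ℂ)}
    (hS : ∀ ψ : Fin 4 → ℂ, (∀ k, normSq (ψ k) = 1) → prodVec ψ (star ψ) ∈ S)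
    {i j : Fin 4} (hij : i ≠ j) : Pi.single (i, j) 1 ∈ S := by
  have key : (Pi.single (i, j) 1 : Fin 4 × Fin 4 → ℂ) = (1 / 16 : ℂ) • ∑ m : Fin 4, ∑ n : Fin 4,
      (star (I ^ (m : ℕ)) * I ^ (n : ℕ)) •
        prodVec (fun k => if k = i then I ^ (m : ℕ) else if k = j then I ^ (n : ℕ) else 1)
          (star fun k => if k = i then I ^ (m : ℕ) else if k = j then I ^ (n : ℕ) else 1) := by
    funext ⟨k, l⟩
    simp only [Pi.single_apply, Prod.mk.injEq, Pi.smul_apply, Finset.sum_apply]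
    simp only [prodVec, Pi.star_apply, smul_eq_mul, Fin.sum_univ_four]
    have hji := hij.symm
    by_cases hki : k = i <;> by_cases hkj : k = j <;> by_cases hli : l = i <;>
      by_cases hlj : l = j <;> simp_all
    · norm_num
    · ring
  rw [key]
  refine S.smul_mem _ (S.sum_mem fun m _ => S.sum_mem fun n _ => S.smul_mem _ (hS _ fun k => ?_))
  split_ifs <;> simp

lemma span_eq_constDiag {s : Set (Fin 4 × Fin 4 → ℂ)} (hdiag : s ⊆ constDiag)
    (hphase : ∀ ψ : Fin 4 → ℂ, (∀ k, normSq (ψ k) = 1) → prodVec ψ (star ψ) ∈ s) :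
    Submodule.span ℂ s = constDiag := by
  refine le_antisymm (Submodule.span_le.2 hdiag) fun v hv => ?_
  have hsub : ∀ ψ : Fin 4 → ℂ, (∀ k, normSq (ψ k) = 1) →
      prodVec ψ (star ψ) ∈ Submodule.span ℂ s := fun ψ hψ => Submodule.subset_span (hphase ψ hψ)
  have key : v = v (0, 0) • prodVec 1 (star 1) +
      ∑ p, (v p - v (0, 0)) • Pi.single p (1 : ℂ) := by
    funext p
    simp [prodVec, Pi.single_apply]
  rw [key]
  refine add_mem (Submodule.smul_mem _ _ (hsub 1 (by simp))) (sum_mem ?_)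
  rintro ⟨i, j⟩ -
  by_cases hij : i = j
  · subst hij
    simp [mem_constDiag.1 hv i]
  · exact Submodule.smul_mem _ _ (single_mem_of_phases hsub hij)

lemma finrank_constDiag_and_ne_top :
    Module.finrank ℂ constDiag = 13 ∧ constDiag ≠ ⊤ := by
  refine ⟨finrank_constDiag, fun h => ?_⟩
  have := finrank_constDiag
  rw [h, finrank_top] at this
  simp at this

lemma span_zeros_W4_one_one_one_zero :
    Submodule.span ℂ {v : Fin 4 × Fin 4 → ℂ |
      ∃ ψ φ : Fin 4 → ℂ, v = prodVec ψ φ ∧ pairing (W4 1 1 1 0) v = 0} = constDiag := by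
  refine span_eq_constDiag ?_ fun ψ hψ => ⟨ψ, star ψ, rfl, ?_⟩
  · rintro _ ⟨ψ, φ, rfl, h⟩
    rw [pairing_W4_prodVec, ofReal_eq_zero, sub_eq_zero] at h
    refine mem_constDiag.2 fun i => mul_eq_of_choi_form_eq_zero ?_ i
    rw [← h]
    exact Finset.sum_congr rfl fun i _ => by ring
  · rw [pairing_W4_prodVec, ofReal_eq_zero]
    simp [← starRingEnd_apply, normSq_conj, mul_conj, hψ]
    norm_num

lemma span_zeros_W4_one_zero_one_one :
    Submodule.span ℂ {v : Fin 4 × Fin 4 → ℂ |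
      ∃ ψ φ : Fin 4 → ℂ, v = prodVec ψ φ ∧ pairing (W4 1 0 1 1) v = 0} = constDiag := by
  refine span_eq_constDiag ?_ fun ψ hψ => ⟨ψ, star ψ, rfl, ?_⟩
  · rintro _ ⟨ψ, φ, rfl, h⟩
    rw [pairing_W4_prodVec, ofReal_eq_zero, sub_eq_zero] at h
    refine mem_constDiag.2 fun i => ?_
    simp only [prodVec, mul_comm (ψ _)]
    refine mul_eq_of_choi_form_eq_zero ?_ i
    simp only [mul_comm (φ _)]
    rw [← h]
    simp only [Fin.sum_univ_four, Fin.reduceAdd]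
    ring
  · rw [pairing_W4_prodVec, ofReal_eq_zero]
    simp [← starRingEnd_apply, normSq_conj, mul_conj, hψ]
    norm_num

/-- for the witnesses `W[1,1,1,0]` and `W[1,0,1,1]` arising from
generalized Choi maps, the product vectors `ψ ⊗ φ` with
`⟨ψ⊗φ|W|ψ⊗φ⟩ = 0` span only a 13-dimensional subspace of `ℂ⁴ ⊗ ℂ⁴`; in
particular they do not span the whole space (no spanning property). -/
theorem W4_Choi_no_spanning :
    (Module.finrank ℂ (Submodule.span ℂ {v : Fin 4 × Fin 4 → ℂ |
        ∃ ψ φ : Fin 4 → ℂ, v = prodVec ψ φ ∧ pairing (W4 1 1 1 0) v = 0}) = 13 ∧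
      Submodule.span ℂ {v : Fin 4 × Fin 4 → ℂ |
        ∃ ψ φ : Fin 4 → ℂ, v = prodVec ψ φ ∧ pairing (W4 1 1 1 0) v = 0} ≠ ⊤) ∧
    (Module.finrank ℂ (Submodule.span ℂ {v : Fin 4 × Fin 4 → ℂ |
        ∃ ψ φ : Fin 4 → ℂ, v = prodVec ψ φ ∧ pairing (W4 1 0 1 1) v = 0}) = 13 ∧
      Submodule.span ℂ {v : Fin 4 × Fin 4 → ℂ |
        ∃ ψ φ : Fin 4 → ℂ, v = prodVec ψ φ ∧ pairing (W4 1 0 1 1) v = 0} ≠ ⊤) := by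
  rw [span_zeros_W4_one_one_one_zero, span_zeros_W4_one_zero_one_one]
  exact ⟨finrank_constDiag_and_ne_top, finrank_constDiag_and_ne_top⟩
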